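/- Let ν ∈ 𝒱₀ and let (f1,f2) be a component of an automorphism of Q which is properly resonant with respect to ν and satisfies ν(f1) < ν(f2). Then for every polynomial R ∈ k[X,Y] ∖ k[Y] (i.e. R of positive degree in X), one has ν(f1 · R(f1,f2)) < (4/3)·ν(f1). -/

import Mathlib

noncomputable section

open MvPolynomial

/-- The polynomial `q = xt - yz` in `k[x,y,z,t]` (variables `x,y,z,t` are `X 0, X 1, X 2, X 3`). -/
def qpoly (k : Type) [Field k] : MvPolynomial (Fin 4) k :=
  X 0 * X 3 - X 1 * X 2

/-- The coordinate ring `k[Q] = k[x,y,z,t]/(xt - yz - 1)` of the affine quadric threefold. -/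
abbrev QuadRing (k : Type) [Field k] : Type :=
  MvPolynomial (Fin 4) k ⧸ Ideal.span {qpoly k - 1}

/-- The canonical projection `π : k[x,y,z,t] → k[Q]`. -/
def qmk (k : Type) [Field k] : MvPolynomial (Fin 4) k →+* QuadRing k :=
  Ideal.Quotient.mk (Ideal.span {qpoly k - 1})

/-- A valuation on a commutative `k`-algebra `A`, with values in `ℝ ∪ {+∞}`:
`ν⁻¹({+∞}) = {0}`, `ν(a) = 0` for `a ∈ k*`, `ν(fg) = ν f + ν g`, and
`ν(f + g) ≥ min (ν f) (ν g)`. -/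
def IsValuation (k : Type) [Field k] (A : Type) [CommRing A] [Algebra k A]
    (ν : A → WithTop ℝ) : Prop :=
  (∀ f : A, ν f = ⊤ ↔ f = 0) ∧
  (∀ a : k, a ≠ 0 → ν (algebraMap k A a) = 0) ∧
  (∀ f g : A, ν (f * g) = ν f + ν g) ∧
  (∀ f g : A, min (ν f) (ν g) ≤ ν (f + g))

/-- The monomial valuation `ν_p^α` on `k[x,y,z,t]` at the point `p` with weights `α`:
the minimum of `⟨I, α⟩` over the exponents `I` appearing in the expansion of `R` in the
shifted variables `x - p₀, y - p₁, z - p₂, t - p₃` (and `+∞` on the zero polynomial). -/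
def mvalP (k : Type) [Field k] (p : Fin 4 → k) (α : Fin 4 → ℝ)
    (R : MvPolynomial (Fin 4) k) : WithTop ℝ :=
  (MvPolynomial.aeval (fun i => X i + C (p i)) R : MvPolynomial (Fin 4) k).support.inf
    fun I => ((∑ i, α i * (I i : ℝ) : ℝ) : WithTop ℝ)

/-- The monomial valuation `ν_0^α` on `k[x,y,z,t]` at the origin with weights `α`. -/
def mvalO (k : Type) [Field k] (α : Fin 4 → ℝ)
    (R : MvPolynomial (Fin 4) k) : WithTop ℝ :=
  R.support.inf fun I => ((∑ i, α i * (I i : ℝ) : ℝ) : WithTop ℝ)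

/-- The map `ν : k[Q] → ℝ ∪ {+∞}` given by `ν(f) = sup {ν_p^α(R) : π R = f}`. -/
def nuSup (k : Type) [Field k] (p : Fin 4 → k) (α : Fin 4 → ℝ)
    (f : QuadRing k) : WithTop ℝ :=
  sSup {v : WithTop ℝ | ∃ R : MvPolynomial (Fin 4) k, qmk k R = f ∧ mvalP k p α R = v}

/-- The set `𝒱₀` of valuations on `k[Q]` obtained from monomial valuations at points
`p ∈ k⁴` with weights `α ∈ (ℝ^{<0})⁴` satisfying `α₀ + α₃ = α₁ + α₂`. -/
def V0 (k : Type) [Field k] : Set (QuadRing k → WithTop ℝ) :=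
  {ν | ∃ (p : Fin 4 → k) (α : Fin 4 → ℝ),
      (∀ i, α i < 0) ∧ α 0 + α 3 = α 1 + α 2 ∧ ν = nuSup k p α}

/-- The Jacobian determinant `Jac(R₁,R₂,R₃,R₄)` of four polynomials in `k[x,y,z,t]`. -/
def jac (k : Type) [Field k] (R : Fin 4 → MvPolynomial (Fin 4) k) :
    MvPolynomial (Fin 4) k :=
  (Matrix.of fun i j : Fin 4 => MvPolynomial.pderiv j (R i)).det

/-- The monomial valuation on `k[X,Y]` with weights `w = (w₁, w₂)`. -/
def mval2 (k : Type) [Field k] (w : Fin 2 → ℝ)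
    (R : MvPolynomial (Fin 2) k) : WithTop ℝ :=
  R.support.inf fun I => ((∑ i, w i * (I i : ℝ) : ℝ) : WithTop ℝ)

open Classical in
/-- The `(w₁,w₂)`-leading part of `R ∈ k[X,Y]`: the sum of the terms of `R` whose
weighted degree realizes the monomial valuation of `R` with weights `w`. -/
def leadPart2 (k : Type) [Field k] (w : Fin 2 → ℝ) (R : MvPolynomial (Fin 2) k) :
    MvPolynomial (Fin 2) k :=
  ∑ I ∈ R.support.filter
      (fun I => ((∑ i, w i * (I i : ℝ) : ℝ) : WithTop ℝ) = mval2 k w R),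
    monomial I (R.coeff I)

open Classical in
/-- The `α`-leading part `R^w` of `R ∈ k[x,y,z,t]` (with respect to the monomial
valuation at the origin with weights `α`). -/
def leadPart4 (k : Type) [Field k] (α : Fin 4 → ℝ) (R : MvPolynomial (Fin 4) k) :
    MvPolynomial (Fin 4) k :=
  ∑ I ∈ R.support.filter
      (fun I => ((∑ i, α i * (I i : ℝ) : ℝ) : WithTop ℝ) = mvalO k α R),
    monomial I (R.coeff I)

/-- `(f₁, f₂)` is a component of an automorphism of `Q`: there is a `k`-algebra
automorphism `σ` of `k[Q]` with `σ x = f₁` and `σ y = f₂`. -/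
def IsComponent (k : Type) [Field k] (f1 f2 : QuadRing k) : Prop :=
  ∃ σ : QuadRing k ≃ₐ[k] QuadRing k, σ (qmk k (X 0)) = f1 ∧ σ (qmk k (X 1)) = f2

/-- `(f₁, f₂)` is critically resonant with respect to `ν`. -/
def CriticallyResonant (k : Type) [Field k] (ν : QuadRing k → WithTop ℝ)
    (f1 f2 : QuadRing k) : Prop :=
  (∃ (m : ℕ) (lam : k), 1 ≤ m ∧ lam ≠ 0 ∧
      ν f1 < ν (f1 - algebraMap k (QuadRing k) lam * f2 ^ m) ∧ ν f1 = m • ν f2) ∨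
  (∃ (m : ℕ) (lam : k), 1 ≤ m ∧ lam ≠ 0 ∧
      ν f2 < ν (f2 - algebraMap k (QuadRing k) lam * f1 ^ m) ∧ ν f2 = m • ν f1)

section HahnSeriesCoefficients

variable {L : Type} [CommRing L]

theorem HahnSeries.coeff_mul_add_of_le_orderTop {x y : HahnSeries ℝ L} {a b : ℝ}
    (hx : (a : WithTop ℝ) ≤ x.orderTop) (hy : (b : WithTop ℝ) ≤ y.orderTop) :
    (x * y).coeff (a + b) = x.coeff a * y.coeff b := by
  rw [HahnSeries.coeff_mul]
  by_cases h : x.coeff a = 0 ∨ y.coeff b = 0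
  · have h0 : x.coeff a * y.coeff b = 0 := by rcases h with h | h <;> simp [h]
    rw [h0]
    refine Finset.sum_eq_zero ?_
    rintro ⟨i, j⟩ hij
    rw [Finset.mem_antidiagonal] at hij
    obtain ⟨hi, hj, hs⟩ := hij
    have hi' : a ≤ i := by
      exact_mod_cast hx.trans (HahnSeries.orderTop_le_of_coeff_ne_zero hi)
    have hj' : b ≤ j := by
      exact_mod_cast hy.trans (HahnSeries.orderTop_le_of_coeff_ne_zero hj)
    simp only at hs
    obtain rfl : i = a := by linarith
    obtain rfl : j = b := by linarith
    rcases h with h | h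
    · exact absurd h hi
    · exact absurd h hj
  · rw [not_or] at h
    rw [Finset.sum_eq_single (a, b)]
    · rintro ⟨i, j⟩ hij hne
      rw [Finset.mem_antidiagonal] at hij
      obtain ⟨hi, hj, hs⟩ := hij
      have hi' : a ≤ i := by
        exact_mod_cast hx.trans (HahnSeries.orderTop_le_of_coeff_ne_zero hi)
      have hj' : b ≤ j := by
        exact_mod_cast hy.trans (HahnSeries.orderTop_le_of_coeff_ne_zero hj)
      simp only at hs
      obtain rfl : i = a := by linarith
      obtain rfl : j = b := by linarith
      exact absurd rfl hne
    · intro hn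
      exact absurd (Finset.mem_antidiagonal.2 ⟨h.1, h.2, rfl⟩) hn

theorem HahnSeries.le_orderTop_mul {x y : HahnSeries ℝ L} {a b : ℝ}
    (hx : (a : WithTop ℝ) ≤ x.orderTop) (hy : (b : WithTop ℝ) ≤ y.orderTop) :
    ((a + b : ℝ) : WithTop ℝ) ≤ (x * y).orderTop := by
  refine le_trans ?_ HahnSeries.orderTop_add_le_mul
  rw [WithTop.coe_add]
  exact add_le_add hx hy

theorem HahnSeries.le_orderTop_one : ((0 : ℝ) : WithTop ℝ) ≤ (1 : HahnSeries ℝ L).orderTop :=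
  HahnSeries.orderTop_single_le

theorem HahnSeries.pow_le_orderTop_and_coeff {x : HahnSeries ℝ L} {a : ℝ}
    (hx : (a : WithTop ℝ) ≤ x.orderTop) (n : ℕ) :
    ((a * n : ℝ) : WithTop ℝ) ≤ (x ^ n).orderTop ∧
      (x ^ n).coeff (a * n) = x.coeff a ^ n := by
  induction n with
  | zero =>
    simp only [pow_zero, Nat.cast_zero, mul_zero]
    exact ⟨HahnSeries.le_orderTop_one, by simp⟩
  | succ n ih =>
    have : a * ((n + 1 : ℕ) : ℝ) = a * n + a := by push_cast; ring
    rw [this, pow_succ, pow_succ, HahnSeries.coeff_mul_add_of_le_orderTop ih.1 hx, ih.2]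
    exact ⟨HahnSeries.le_orderTop_mul ih.1 hx, rfl⟩

theorem HahnSeries.prod_le_orderTop_and_coeff {ι : Type} (s : Finset ι)
    {x : ι → HahnSeries ℝ L} {a : ι → ℝ} (hx : ∀ i, (a i : WithTop ℝ) ≤ (x i).orderTop) :
    ((∑ i ∈ s, a i : ℝ) : WithTop ℝ) ≤ (∏ i ∈ s, x i).orderTop ∧
      (∏ i ∈ s, x i).coeff (∑ i ∈ s, a i) = ∏ i ∈ s, (x i).coeff (a i) := by
  classical
  induction s using Finset.induction_on with
  | empty => exact ⟨HahnSeries.le_orderTop_one, by simp⟩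
  | insert i s hi ih =>
    rw [Finset.prod_insert hi, Finset.prod_insert hi, Finset.sum_insert hi,
      HahnSeries.coeff_mul_add_of_le_orderTop (hx i) ih.1, ih.2]
    exact ⟨HahnSeries.le_orderTop_mul (hx i) ih.1, rfl⟩

theorem HahnSeries.le_orderTop_sum {ι : Type} (s : Finset ι) {x : ι → HahnSeries ℝ L}
    {v : WithTop ℝ} (hx : ∀ i ∈ s, v ≤ (x i).orderTop) : v ≤ (∑ i ∈ s, x i).orderTop := by
  rw [HahnSeries.le_orderTop_iff_forall]
  intro j hj
  rw [HahnSeries.coeff_sum]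
  exact Finset.sum_eq_zero fun i hi =>
    HahnSeries.coeff_eq_zero_of_lt_orderTop (hj.trans_le (hx i hi))

/-- The initial form of weight `W` of a polynomial over Hahn series, when the variable has
weight `a`. -/
def initialForm (a W : ℝ) (P : Polynomial (HahnSeries ℝ L)) : Polynomial L :=
  ∑ i ∈ Finset.range (P.natDegree + 1),
    Polynomial.monomial i ((P.coeff i).coeff (W - a * i))

theorem coeff_initialForm (a W : ℝ) (P : Polynomial (HahnSeries ℝ L)) (i : ℕ) :
    (initialForm a W P).coeff i = (P.coeff i).coeff (W - a * i) := by
  rw [initialForm, Polynomial.finsetSum_coeff]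
  simp only [Polynomial.coeff_monomial]
  rw [Finset.sum_ite_eq']
  split_ifs with h
  · rfl
  · rw [Polynomial.coeff_eq_zero_of_natDegree_lt (by simpa using h)]; rfl

theorem initialForm_derivative (a W : ℝ) (P : Polynomial (HahnSeries ℝ L)) :
    initialForm a (W - a) (Polynomial.derivative P) =
      Polynomial.derivative (initialForm a W P) := by
  ext i
  rw [coeff_initialForm, Polynomial.coeff_derivative, Polynomial.coeff_derivative,
    coeff_initialForm]
  have h1 : W - a - a * (i : ℝ) = W - a * ((i + 1 : ℕ) : ℝ) := by push_cast; ring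
  have h2 : ((i : HahnSeries ℝ L) + 1) = HahnSeries.C ((i : L) + 1) := by
    rw [map_add, map_natCast, map_one]
  rw [h1, h2, mul_comm, HahnSeries.C_mul_eq_smul, HahnSeries.coeff_smul, smul_eq_mul, mul_comm]

theorem initialForm_iterate_derivative (a W : ℝ) (P : Polynomial (HahnSeries ℝ L)) (n : ℕ) :
    initialForm a (W - a * n) (Polynomial.derivative^[n] P) =
      Polynomial.derivative^[n] (initialForm a W P) := by
  induction n with
  | zero => simp
  | succ n ih =>
    rw [Function.iterate_succ_apply', Function.iterate_succ_apply', ← ih,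
      ← initialForm_derivative]
    congr 1
    push_cast; ring

theorem le_orderTop_coeff_iterate_derivative {a W : ℝ} {P : Polynomial (HahnSeries ℝ L)}
    (hP : ∀ i : ℕ, ((W - a * i : ℝ) : WithTop ℝ) ≤ (P.coeff i).orderTop) (n : ℕ) (i : ℕ) :
    ((W - a * n - a * i : ℝ) : WithTop ℝ) ≤
      ((Polynomial.derivative^[n] P).coeff i).orderTop := by
  rw [Polynomial.coeff_iterate_derivative]
  have h1 : W - a * n - a * (i : ℝ) = W - a * ((i + n : ℕ) : ℝ) := by push_cast; ring
  rw [h1, nsmul_eq_mul]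
  have h2 : (((i + n).descFactorial n : ℕ) : HahnSeries ℝ L) =
    HahnSeries.C (((i + n).descFactorial n : ℕ) : L) := by
    rw [map_natCast]
  rw [h2, HahnSeries.C_mul_eq_smul]
  exact (hP _).trans (HahnSeries.orderTop_le_orderTop_smul _ _)

theorem le_orderTop_eval_and_coeff {a W : ℝ} {P : Polynomial (HahnSeries ℝ L)}
    (hP : ∀ i : ℕ, ((W - a * i : ℝ) : WithTop ℝ) ≤ (P.coeff i).orderTop)
    {φ : HahnSeries ℝ L} (hφ : (a : WithTop ℝ) ≤ φ.orderTop) :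
    (W : WithTop ℝ) ≤ (P.eval φ).orderTop ∧
      (P.eval φ).coeff W = (initialForm a W P).eval (φ.coeff a) := by
  have key : ∀ i : ℕ, (W : WithTop ℝ) ≤ (P.coeff i * φ ^ i).orderTop ∧
      (P.coeff i * φ ^ i).coeff W = (P.coeff i).coeff (W - a * i) * φ.coeff a ^ i := by
    intro i
    have h := HahnSeries.pow_le_orderTop_and_coeff hφ i
    have e : W = (W - a * i) + a * i := by ring
    constructor
    · conv_lhs => rw [e]
      exact HahnSeries.le_orderTop_mul (hP i) h.1
    · conv_lhs => rw [e]
      rw [HahnSeries.coeff_mul_add_of_le_orderTop (hP i) h.1, h.2]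
  constructor
  · rw [Polynomial.eval_eq_sum_range]
    exact HahnSeries.le_orderTop_sum _ fun i _ => (key i).1
  · rw [Polynomial.eval_eq_sum_range, HahnSeries.coeff_sum, initialForm,
      Polynomial.eval_finsetSum]
    exact Finset.sum_congr rfl fun i _ => by rw [(key i).2, Polynomial.eval_monomial]

end HahnSeriesCoefficients

/-- If the exponents of `p` are all congruent modulo `s`, then `p` has at least `s` roots of
the same multiplicity as a given nonzero root. -/
theorem mul_rootMultiplicity_le_natDegree {L : Type} [CommRing L] [IsDomain L]
    {p : Polynomial L} (hp : p ≠ 0) {s : ℕ} (hs : 0 < s) {ζ : L} (hζ : IsPrimitiveRoot ζ s)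
    (hmod : ∀ i j, p.coeff i ≠ 0 → p.coeff j ≠ 0 → i ≡ j [MOD s]) {c : L} (hc : c ≠ 0) :
    s * p.rootMultiplicity c ≤ p.natDegree := by
  classical
  obtain ⟨i₀, hi₀⟩ : ∃ i, p.coeff i ≠ 0 := by
    by_contra! h
    exact hp (Polynomial.ext fun i => by simpa using h i)
  have hpow : ∀ i, p.coeff i ≠ 0 → ζ ^ i = ζ ^ i₀ := fun i hi => by
    have := hmod i i₀ hi hi₀
    rw [← pow_mod_orderOf, ← hζ.eq_orderOf, this, hζ.eq_orderOf, pow_mod_orderOf]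
  have hcomp : ∀ m : ℕ, p.comp (Polynomial.C (ζ ^ m) * Polynomial.X) =
      Polynomial.C (ζ ^ (m * i₀)) * p := by
    intro m
    ext i
    rw [Polynomial.comp_C_mul_X_coeff, Polynomial.coeff_C_mul]
    by_cases hi : p.coeff i = 0
    · simp [hi]
    · rw [← pow_mul, mul_comm m i, pow_mul, hpow i hi, ← pow_mul, mul_comm i₀ m, mul_comm]
  set n := p.rootMultiplicity c with hn
  have hdvd : ∀ m < s, (Polynomial.X - Polynomial.C (ζ ^ m * c)) ^ n ∣ p := by
    intro m hm
    obtain ⟨r, hr⟩ := Polynomial.pow_rootMultiplicity_dvd p c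
    rw [← hn] at hr
    have hone : ζ ^ (s - m) * ζ ^ m = 1 := by
      rw [← pow_add, Nat.sub_add_cancel hm.le, hζ.pow_eq_one]
    have hX : (Polynomial.X - Polynomial.C c).comp
        (Polynomial.C (ζ ^ (s - m)) * Polynomial.X) =
        Polynomial.C (ζ ^ (s - m)) * (Polynomial.X - Polynomial.C (ζ ^ m * c)) := by
      rw [Polynomial.sub_comp, Polynomial.X_comp, Polynomial.C_comp, mul_sub,
        ← Polynomial.C_mul, ← mul_assoc, hone, one_mul]
    have hunit : IsUnit (Polynomial.C (ζ ^ ((s - m) * i₀))) :=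
      Polynomial.isUnit_C.2 ((hζ.isUnit hs.ne').pow _)
    rw [← hunit.dvd_mul_left, ← hcomp, hr, Polynomial.mul_comp, Polynomial.pow_comp, hX, mul_pow]
    exact (dvd_mul_left _ _).mul_right _
  set T : Finset L := (Finset.range s).image fun m => ζ ^ m * c with hT
  have hcard : T.card = s := by
    rw [hT, Finset.card_image_of_injOn, Finset.card_range]
    intro x hx y hy hxy
    exact hζ.pow_inj (by simpa using hx) (by simpa using hy) (mul_right_cancel₀ hc hxy)
  have hle : n • T.val ≤ p.roots := by
    rw [Multiset.le_iff_count]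
    intro x
    rw [Multiset.count_nsmul]
    by_cases hx : x ∈ T
    · rw [Multiset.count_eq_one_of_mem T.nodup hx, mul_one, Polynomial.count_roots,
        Polynomial.le_rootMultiplicity_iff hp]
      obtain ⟨m, hm, rfl⟩ := Finset.mem_image.1 hx
      exact hdvd m (Finset.mem_range.1 hm)
    · rw [Multiset.count_eq_zero_of_notMem (by simpa using hx)]
      simp
  have h := (Multiset.card_le_card hle).trans (Polynomial.card_roots' p)
  rw [Multiset.card_nsmul] at h
  calc s * n = n * T.card := by rw [hcard, mul_comm]
    _ ≤ _ := by simpa using h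

section WeightFiltration

/-- The weight of a multi-exponent. -/
def expWeight (α : Fin 4 → ℝ) (I : Fin 4 →₀ ℕ) : ℝ := ∑ i, α i * (I i : ℝ)

theorem expWeight_add (α : Fin 4 → ℝ) (I J : Fin 4 →₀ ℕ) :
    expWeight α (I + J) = expWeight α I + expWeight α J := by
  simp [expWeight, mul_add, Finset.sum_add_distrib]

theorem expWeight_single (α : Fin 4 → ℝ) (i : Fin 4) (n : ℕ) :
    expWeight α (Finsupp.single i n) = α i * n := by
  rw [expWeight, Finset.sum_eq_single i]
  · simp
  · intro j _ hj; simp [hj.symm]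
  · simp

theorem expWeight_nonpos {α : Fin 4 → ℝ} (hα : ∀ i, α i < 0) (I : Fin 4 →₀ ℕ) :
    expWeight α I ≤ 0 :=
  Finset.sum_nonpos fun i _ => mul_nonpos_of_nonpos_of_nonneg (hα i).le (Nat.cast_nonneg _)

variable {k : Type} [Field k]

/-- Polynomials all of whose monomials have weight at least `v`. -/
def weightGE (k : Type) [Field k] (α : Fin 4 → ℝ) (v : ℝ) :
    Submodule k (MvPolynomial (Fin 4) k) where
  carrier := {R | ∀ I, R.coeff I ≠ 0 → v ≤ expWeight α I}
  zero_mem' := fun I h => absurd (coeff_zero I) h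
  add_mem' := by
    intro R S hR hS I h
    rw [coeff_add] at h
    by_cases h1 : R.coeff I = 0
    · exact hS I fun h2 => h (by rw [h1, h2, add_zero])
    · exact hR I h1
  smul_mem' := by
    intro c R hR I h
    rw [coeff_smul] at h
    exact hR I (right_ne_zero_of_smul h)

theorem mem_weightGE {α : Fin 4 → ℝ} {v : ℝ} {R : MvPolynomial (Fin 4) k} :
    R ∈ weightGE k α v ↔ ∀ I, R.coeff I ≠ 0 → v ≤ expWeight α I := Iff.rfl

theorem weightGE_mono {α : Fin 4 → ℝ} {v w : ℝ} (h : v ≤ w) {R : MvPolynomial (Fin 4) k}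
    (hR : R ∈ weightGE k α w) : R ∈ weightGE k α v := fun I hI => h.trans (hR I hI)

theorem le_mvalO_iff {α : Fin 4 → ℝ} {v : ℝ} {R : MvPolynomial (Fin 4) k} :
    (v : WithTop ℝ) ≤ mvalO k α R ↔ R ∈ weightGE k α v := by
  rw [mvalO, Finset.le_inf_iff, mem_weightGE]
  simp only [mem_support_iff, WithTop.coe_le_coe, expWeight]

theorem mul_mem_weightGE {α : Fin 4 → ℝ} {v w : ℝ} {R S : MvPolynomial (Fin 4) k}
    (hR : R ∈ weightGE k α v) (hS : S ∈ weightGE k α w) : R * S ∈ weightGE k α (v + w) := by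
  classical
  intro I hI
  have := support_mul R S (mem_support_iff.2 hI)
  obtain ⟨J, hJ, K, hK, rfl⟩ := Finset.mem_add.1 this
  rw [expWeight_add]
  exact add_le_add (hR J (mem_support_iff.1 hJ)) (hS K (mem_support_iff.1 hK))

theorem monomial_mem_weightGE (α : Fin 4 → ℝ) (I : Fin 4 →₀ ℕ) (c : k) :
    monomial I c ∈ weightGE k α (expWeight α I) := by
  classical
  intro J hJ
  rw [coeff_monomial] at hJ
  split_ifs at hJ with h
  · rw [h]
  · exact absurd rfl hJ

theorem C_mem_weightGE (α : Fin 4 → ℝ) (c : k) : C c ∈ weightGE k α 0 := by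
  have := monomial_mem_weightGE α 0 c
  simpa [expWeight] using this

theorem X_mem_weightGE (α : Fin 4 → ℝ) (i : Fin 4) :
    (X i : MvPolynomial (Fin 4) k) ∈ weightGE k α (α i) := by
  have := monomial_mem_weightGE α (Finsupp.single i 1) (1 : k)
  rwa [expWeight_single, Nat.cast_one, mul_one] at this

theorem prod_mem_weightGE {ι : Type} {α : Fin 4 → ℝ} (s : Finset ι) {v : ι → ℝ}
    {R : ι → MvPolynomial (Fin 4) k} (hR : ∀ i, R i ∈ weightGE k α (v i)) :
    ∏ i ∈ s, R i ∈ weightGE k α (∑ i ∈ s, v i) := by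
  classical
  induction s using Finset.induction_on with
  | empty => simpa using C_mem_weightGE α (1 : k)
  | insert i s hi ih =>
    rw [Finset.prod_insert hi, Finset.sum_insert hi]
    exact mul_mem_weightGE (hR i) ih

theorem pow_mem_weightGE {α : Fin 4 → ℝ} {v : ℝ} {R : MvPolynomial (Fin 4) k}
    (hR : R ∈ weightGE k α v) (n : ℕ) : R ^ n ∈ weightGE k α (v * n) := by
  have := prod_mem_weightGE (Finset.range n) (v := fun _ => v) (R := fun _ => R) fun _ => hR
  simpa [mul_comm] using this

theorem pderiv_mem_weightGE {α : Fin 4 → ℝ} {v : ℝ} {R : MvPolynomial (Fin 4) k}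
    (hR : R ∈ weightGE k α v) (i : Fin 4) : pderiv i R ∈ weightGE k α (v - α i) := by
  rw [R.as_sum, map_sum]
  refine Submodule.sum_mem _ fun I hI => ?_
  rw [pderiv_monomial]
  by_cases h : I i = 0
  · simp [h]
  · refine weightGE_mono ?_ (monomial_mem_weightGE _ _ _)
    have h1 := hR I (mem_support_iff.1 hI)
    have h2 : I = (I - Finsupp.single i 1) + Finsupp.single i 1 := by
      rw [tsub_add_cancel_of_le]
      rw [Finsupp.single_le_iff]
      omega
    rw [h2, expWeight_add, expWeight_single] at h1
    push_cast at h1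
    linarith

theorem jac_mem_weightGE {α v : Fin 4 → ℝ} {R : Fin 4 → MvPolynomial (Fin 4) k}
    (hR : ∀ i, R i ∈ weightGE k α (v i)) :
    jac k R ∈ weightGE k α (∑ i, v i - ∑ i, α i) := by
  rw [jac, Matrix.det_apply]
  refine Submodule.sum_mem _ fun σ _ => ?_
  rw [Units.smul_def]
  refine zsmul_mem ?_ _
  have := prod_mem_weightGE (α := α) Finset.univ
    (v := fun i => v (σ i) - α i)
    (R := fun i => pderiv i (R (σ i))) fun i => pderiv_mem_weightGE (hR _) _
  rw [Finset.sum_sub_distrib, Equiv.sum_comp σ v] at this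
  exact this

theorem qpoly_mem_weightGE {α : Fin 4 → ℝ} (hsum : α 0 + α 3 = α 1 + α 2) :
    qpoly k ∈ weightGE k α (α 0 + α 3) := by
  refine Submodule.sub_mem _ (mul_mem_weightGE (X_mem_weightGE α 0) (X_mem_weightGE α 3)) ?_
  rw [hsum]
  exact mul_mem_weightGE (X_mem_weightGE α 1) (X_mem_weightGE α 2)

theorem translate_mem_weightGE {α : Fin 4 → ℝ} (hα : ∀ i, α i < 0) (p : Fin 4 → k) {v : ℝ}
    {R : MvPolynomial (Fin 4) k} (hR : R ∈ weightGE k α v) :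
    (aeval (fun i => X i + C (p i)) R : MvPolynomial (Fin 4) k) ∈ weightGE k α v := by
  rw [aeval_def, eval₂_eq']
  refine Submodule.sum_mem _ fun I hI => ?_
  rw [algebraMap_eq]
  have h1 : ∏ i, (X i + C (p i)) ^ (I i) ∈ weightGE k α (expWeight α I) :=
    prod_mem_weightGE _ fun i => pow_mem_weightGE
      (Submodule.add_mem _ (X_mem_weightGE α i)
        (weightGE_mono (hα i).le (C_mem_weightGE α (p i)))) _
  have h2 := mul_mem_weightGE (C_mem_weightGE α (R.coeff I)) h1
  rw [zero_add] at h2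
  exact weightGE_mono (hR I (mem_support_iff.1 hI)) h2

end WeightFiltration

section HahnEmbedding

variable {k : Type} [Field k]

/-- Exponents of the leading Laurent monomials of `x`, `y`, `z`, `t = (1 + yz) / x`. -/
def leadExp : Fin 4 → ℤ × ℤ × ℤ := ![(1, 0, 0), (0, 1, 0), (0, 0, 1), (-1, 1, 1)]

/-- The images of `x`, `y`, `z`, `t` in Hahn series over the ring of Laurent polynomials. -/
def hahnGen (k : Type) [Field k] (α : Fin 4 → ℝ) :
    Fin 4 → HahnSeries ℝ (AddMonoidAlgebra k (ℤ × ℤ × ℤ)) :=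
  ![HahnSeries.single (α 0) (AddMonoidAlgebra.single (1, 0, 0) 1),
    HahnSeries.single (α 1) (AddMonoidAlgebra.single (0, 1, 0) 1),
    HahnSeries.single (α 2) (AddMonoidAlgebra.single (0, 0, 1) 1),
    HahnSeries.single (α 3) (AddMonoidAlgebra.single (-1, 1, 1) 1) +
      HahnSeries.single (-α 0) (AddMonoidAlgebra.single (-1, 0, 0) 1)]

theorem hahnGen_le_orderTop {α : Fin 4 → ℝ} (hα : ∀ i, α i < 0) (i : Fin 4) :
    (α i : WithTop ℝ) ≤ (hahnGen k α i).orderTop := by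
  fin_cases i
  · exact HahnSeries.orderTop_single_le
  · exact HahnSeries.orderTop_single_le
  · exact HahnSeries.orderTop_single_le
  · refine le_trans (le_min HahnSeries.orderTop_single_le (le_trans ?_
      HahnSeries.orderTop_single_le)) HahnSeries.min_orderTop_le_orderTop_add
    have h0 := hα 0
    have h3 := hα 3
    exact WithTop.coe_le_coe.2 (show α 3 ≤ -α 0 by linarith)

theorem hahnGen_coeff {α : Fin 4 → ℝ} (hα : ∀ i, α i < 0) (i : Fin 4) :
    (hahnGen k α i).coeff (α i) = AddMonoidAlgebra.single (leadExp i) 1 := by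
  fin_cases i
  · exact HahnSeries.coeff_single_same _ _
  · exact HahnSeries.coeff_single_same _ _
  · exact HahnSeries.coeff_single_same _ _
  · have h0 := hα 0
    have h3 := hα 3
    have hne : α 3 ≠ -α 0 := by linarith
    change (HahnSeries.single (α 3)
      (AddMonoidAlgebra.single (-1, 1, 1) 1 : AddMonoidAlgebra k (ℤ × ℤ × ℤ)) +
      HahnSeries.single (-α 0) (AddMonoidAlgebra.single (-1, 0, 0) 1)).coeff (α 3) =
      (AddMonoidAlgebra.single (-1, 1, 1) 1 : AddMonoidAlgebra k (ℤ × ℤ × ℤ))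
    rw [HahnSeries.coeff_add, HahnSeries.coeff_single_same, HahnSeries.coeff_single_of_ne hne,
      add_zero]

/-- The ring homomorphism `k[x,y,z,t] → HahnSeries` sending the variables to `hahnGen`. -/
def hahnEval (k : Type) [Field k] (α : Fin 4 → ℝ) :
    MvPolynomial (Fin 4) k →+* HahnSeries ℝ (AddMonoidAlgebra k (ℤ × ℤ × ℤ)) :=
  eval₂Hom (HahnSeries.C.comp (algebraMap k _)) (hahnGen k α)

theorem hahnEval_qpoly {α : Fin 4 → ℝ} (hsum : α 0 + α 3 = α 1 + α 2) :
    hahnEval k α (qpoly k - 1) = 0 := by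
  have e3 : hahnEval k α (X 3) =
      HahnSeries.single (α 3) (AddMonoidAlgebra.single (-1, 1, 1) 1) +
      HahnSeries.single (-α 0) (AddMonoidAlgebra.single (-1, 0, 0) 1) := eval₂Hom_X' _ _ _
  have e0 : hahnEval k α (X 0) =
      HahnSeries.single (α 0) (AddMonoidAlgebra.single (1, 0, 0) 1) := eval₂Hom_X' _ _ _
  have e1 : hahnEval k α (X 1) =
      HahnSeries.single (α 1) (AddMonoidAlgebra.single (0, 1, 0) 1) := eval₂Hom_X' _ _ _
  have e2 : hahnEval k α (X 2) =
      HahnSeries.single (α 2) (AddMonoidAlgebra.single (0, 0, 1) 1) := eval₂Hom_X' _ _ _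
  rw [qpoly, map_sub, map_sub, map_mul, map_mul, map_one, e0, e1, e2, e3, mul_add]
  simp only [HahnSeries.single_mul_single, AddMonoidAlgebra.single_mul_single, ← hsum, mul_one,
    Prod.mk_add_mk, add_neg_cancel, zero_add, add_zero]
  have e : (HahnSeries.single (0 : ℝ)) (AddMonoidAlgebra.single ((0, 0, 0) : ℤ × ℤ × ℤ) (1 : k)) =
      1 := rfl
  rw [e]
  ring

/-- The embedding of `k[Q]` into Hahn series. -/
def hahnHom (k : Type) [Field k] (α : Fin 4 → ℝ) (hsum : α 0 + α 3 = α 1 + α 2) :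
    QuadRing k →+* HahnSeries ℝ (AddMonoidAlgebra k (ℤ × ℤ × ℤ)) :=
  Ideal.Quotient.lift _ (hahnEval k α) fun a ha => by
    obtain ⟨c, rfl⟩ := Ideal.mem_span_singleton.1 ha
    rw [map_mul, hahnEval_qpoly hsum, zero_mul]

theorem hahnHom_qmk {α : Fin 4 → ℝ} (hsum : α 0 + α 3 = α 1 + α 2)
    (R : MvPolynomial (Fin 4) k) : hahnHom k α hsum (qmk k R) = hahnEval k α R :=
  Ideal.Quotient.lift_mk _ _ _

/-- The leading exponent of a monomial. -/
def leadExpSum (I : Fin 4 →₀ ℕ) : ℤ × ℤ × ℤ := ∑ i, I i • leadExp i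

theorem leadExpSum_inj {I J : Fin 4 →₀ ℕ} (hI : I 0 = 0 ∨ I 3 = 0) (hJ : J 0 = 0 ∨ J 3 = 0)
    (h : leadExpSum I = leadExpSum J) : I = J := by
  simp only [leadExpSum, leadExp, Fin.sum_univ_four, Prod.ext_iff] at h
  simp at h
  ext i
  fin_cases i <;> simp <;> omega

theorem hahnEval_monomial {α : Fin 4 → ℝ} (hα : ∀ i, α i < 0) (I : Fin 4 →₀ ℕ) (c : k) :
    (expWeight α I : WithTop ℝ) ≤ (hahnEval k α (monomial I c)).orderTop ∧
      (hahnEval k α (monomial I c)).coeff (expWeight α I) =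
        AddMonoidAlgebra.single (leadExpSum I) c := by
  have h := fun i => HahnSeries.pow_le_orderTop_and_coeff (hahnGen_le_orderTop (k := k) hα i) (I i)
  have h' := HahnSeries.prod_le_orderTop_and_coeff Finset.univ
    (x := fun i => hahnGen k α i ^ I i) fun i => (h i).1
  have e : hahnEval k α (monomial I c) =
      HahnSeries.C (algebraMap k _ c) * ∏ i, hahnGen k α i ^ I i := by
    rw [hahnEval, coe_eval₂Hom, eval₂_monomial, Finsupp.prod_fintype _ _ (by simp)]
    rfl
  rw [e, HahnSeries.C_mul_eq_smul]
  refine ⟨h'.1.trans (HahnSeries.orderTop_le_orderTop_smul _ _), ?_⟩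
  rw [HahnSeries.coeff_smul]
  refine (congrArg _ h'.2).trans ?_
  have e2 : ∏ i, (hahnGen k α i ^ I i).coeff (α i * I i) =
      AddMonoidAlgebra.single (leadExpSum I) 1 := by
    simp only [(h _).2, hahnGen_coeff hα, AddMonoidAlgebra.single_pow, one_pow]
    simp only [Fin.prod_univ_four, AddMonoidAlgebra.single_mul_single, mul_one, leadExpSum,
      Fin.sum_univ_four]
  rw [e2, smul_eq_mul, AddMonoidAlgebra.coe_algebraMap, Function.comp_apply,
    AddMonoidAlgebra.single_mul_single, zero_add, mul_one]
  rfl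

theorem hahnEval_le_orderTop {α : Fin 4 → ℝ} (hα : ∀ i, α i < 0) {v : ℝ}
    {R : MvPolynomial (Fin 4) k} (hR : R ∈ weightGE k α v) :
    (v : WithTop ℝ) ≤ (hahnEval k α R).orderTop := by
  rw [R.as_sum, map_sum]
  exact HahnSeries.le_orderTop_sum _ fun I hI =>
    (WithTop.coe_le_coe.2 (hR I (mem_support_iff.1 hI))).trans (hahnEval_monomial hα I _).1

/-- Polynomials without monomials divisible by `xt`. -/
def reducedPoly (k : Type) [Field k] : Submodule k (MvPolynomial (Fin 4) k) :=
  restrictSupport k {I | I 0 = 0 ∨ I 3 = 0}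

theorem hahnEval_orderTop_of_reduced {α : Fin 4 → ℝ} (hα : ∀ i, α i < 0)
    {R : MvPolynomial (Fin 4) k} (hR : R ∈ reducedPoly k) (h0 : R ≠ 0) :
    ∃ v : ℝ, v ≤ 0 ∧ R ∈ weightGE k α v ∧ (hahnEval k α R).orderTop = v := by
  classical
  obtain ⟨I, hI, hmin⟩ := R.support.exists_min_image (expWeight α) (support_nonempty.2 h0)
  have hv : R ∈ weightGE k α (expWeight α I) := fun J hJ => hmin J (mem_support_iff.2 hJ)
  refine ⟨expWeight α I, expWeight_nonpos hα I, hv, le_antisymm ?_ (hahnEval_le_orderTop hα hv)⟩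
  refine HahnSeries.orderTop_le_of_coeff_ne_zero fun hc => ?_
  have h1 : ((hahnEval k α R).coeff (expWeight α I)).coeff (leadExpSum I) = 0 := by
    rw [hc]; rfl
  have h2 : (hahnEval k α R).coeff (expWeight α I) = ∑ J ∈ R.support,
      (hahnEval k α (monomial J (R.coeff J))).coeff (expWeight α I) := by
    conv_lhs => rw [R.as_sum]
    rw [map_sum, HahnSeries.coeff_sum]
  rw [h2, AddMonoidAlgebra.coeff_sum, Finsupp.finsetSum_apply, Finset.sum_eq_single I] at h1
  · rw [(hahnEval_monomial hα I _).2, AddMonoidAlgebra.coeff_single, Finsupp.single_eq_same] at h1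
    exact mem_support_iff.1 hI h1
  · intro J hJ hne
    rcases (hmin J hJ).lt_or_eq with hlt | heq
    · rw [HahnSeries.coeff_eq_zero_of_lt_orderTop
        ((WithTop.coe_lt_coe.2 hlt).trans_le (hahnEval_monomial hα J _).1)]
      rfl
    · rw [heq, (hahnEval_monomial hα J _).2, AddMonoidAlgebra.coeff_single,
        Finsupp.single_eq_of_ne]
      exact fun h => hne (leadExpSum_inj (hR hJ) (hR hI) h.symm)
  · intro h
    exact absurd hI h

end HahnEmbedding

section ValuationAsOrder

variable {k : Type} [Field k]

theorem monomial_mem_reducedPoly {I : Fin 4 →₀ ℕ} (hI : I 0 = 0 ∨ I 3 = 0) (c : k) :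
    monomial I c ∈ reducedPoly k := by
  classical
  intro J hJ
  replace hJ : J ∈ (monomial I c : MvPolynomial (Fin 4) k).support := hJ
  rw [mem_support_iff, coeff_monomial] at hJ
  split_ifs at hJ with h
  · exact h ▸ hI
  · exact absurd rfl hJ

theorem reducedPoly_induction {p : MvPolynomial (Fin 4) k → Prop}
    (hmon : ∀ (I : Fin 4 →₀ ℕ) (c : k), (I 0 = 0 ∨ I 3 = 0) → p (monomial I c))
    (hzero : p 0) (hadd : ∀ R S, p R → p S → p (R + S))
    {R : MvPolynomial (Fin 4) k} (hR : R ∈ reducedPoly k) : p R := by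
  rw [R.as_sum]
  exact Finset.sum_induction _ p hadd hzero fun I hI => hmon I _ (hR hI)

theorem qmk_X_zero_mul_X_three :
    qmk k (X 0 * X 3) = qmk k (1 + X 1 * X 2) := by
  refine Ideal.Quotient.eq.2 (Ideal.mem_span_singleton.2 ⟨1, ?_⟩)
  rw [qpoly]; ring

theorem exists_reduced_X_mul (i : Fin 4) {R : MvPolynomial (Fin 4) k} (hR : R ∈ reducedPoly k) :
    ∃ S ∈ reducedPoly k, qmk k S = qmk k (X i * R) := by
  classical
  refine reducedPoly_induction (p := fun R => ∃ S ∈ reducedPoly k, qmk k S = qmk k (X i * R))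
    ?_ ⟨0, Submodule.zero_mem _, by simp⟩ ?_ hR
  · intro I c hI
    have step : ∀ J : Fin 4 →₀ ℕ, X i * monomial J c = monomial (Finsupp.single i 1 + J) c := by
      intro J; rw [X, monomial_mul, one_mul]
    by_cases h : (Finsupp.single i 1 + I : Fin 4 →₀ ℕ) 0 = 0 ∨
        (Finsupp.single i 1 + I : Fin 4 →₀ ℕ) 3 = 0
    · exact ⟨_, monomial_mem_reducedPoly h c, by rw [step]⟩
    · have hmul : ∀ (a b : Fin 4) (J : Fin 4 →₀ ℕ), I = Finsupp.single b 1 + J → a = i →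
          (a = 0 ∧ b = 3 ∨ a = 3 ∧ b = 0) → (J 0 = 0 ∨ J 3 = 0) →
          ∃ S ∈ reducedPoly k, qmk k S = qmk k (X i * monomial I c) := by
        rintro a b J hJ rfl hab hJ0
        refine ⟨(1 + X 1 * X 2) * monomial J c, ?_, ?_⟩
        · have e : (1 + X 1 * X 2) * monomial J c = monomial J c +
              monomial (Finsupp.single 1 1 + (Finsupp.single 2 1 + J)) c := by
            rw [add_mul, one_mul, mul_assoc, X, X, monomial_mul, monomial_mul, one_mul, one_mul]
          rw [e]
          refine Submodule.add_mem _ (monomial_mem_reducedPoly hJ0 c)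
            (monomial_mem_reducedPoly ?_ c)
          simpa using hJ0
        · have e : (monomial I c : MvPolynomial (Fin 4) k) = X b * monomial J c := by
            rw [X, monomial_mul, one_mul, hJ]
          rw [e, ← mul_assoc, map_mul, ← qmk_X_zero_mul_X_three, ← map_mul]
          rcases hab with ⟨rfl, rfl⟩ | ⟨rfl, rfl⟩
          · rfl
          · rw [mul_comm (X 0) (X 3)]
      rw [not_or] at h
      have hsub : ∀ b : Fin 4, I b ≠ 0 → I = Finsupp.single b 1 + (I - Finsupp.single b 1) := by
        intro b hb
        rw [add_tsub_cancel_of_le]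
        rw [Finsupp.single_le_iff]
        omega
      fin_cases i
      · refine hmul 0 3 _ (hsub 3 ?_) rfl (by simp) ?_
        · simpa using h.2
        · have := h.2
          simp at this ⊢; omega
      · simp at h; omega
      · simp at h; omega
      · refine hmul 3 0 _ (hsub 0 ?_) rfl (by simp) ?_
        · simpa using h.1
        · have := h.1
          simp at this ⊢; omega
  · rintro R S ⟨R', hR', eR⟩ ⟨S', hS', eS⟩
    exact ⟨R' + S', Submodule.add_mem _ hR' hS', by rw [map_add, eR, eS, mul_add, map_add]⟩

theorem exists_reduced (f : QuadRing k) : ∃ R ∈ reducedPoly k, qmk k R = f := by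
  obtain ⟨P, rfl⟩ := Ideal.Quotient.mk_surjective f
  induction P using MvPolynomial.induction_on with
  | C c => exact ⟨C c, monomial_mem_reducedPoly (by simp) c, rfl⟩
  | add P P' h h' =>
    obtain ⟨R, hR, eR⟩ := h
    obtain ⟨S, hS, eS⟩ := h'
    exact ⟨R + S, Submodule.add_mem _ hR hS, by rw [map_add, eR, eS, map_add]⟩
  | mul_X P i h =>
    obtain ⟨R, hR, eR⟩ := h
    obtain ⟨S, hS, eS⟩ := exists_reduced_X_mul i hR
    exact ⟨S, hS, by rw [eS, map_mul, eR, mul_comm, map_mul]; rfl⟩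

theorem exists_rep {α : Fin 4 → ℝ} (hα : ∀ i, α i < 0) (hsum : α 0 + α 3 = α 1 + α 2)
    {f : QuadRing k} (hf : f ≠ 0) :
    ∃ v : ℝ, v ≤ 0 ∧ (∃ R ∈ weightGE k α v, qmk k R = f) ∧
      (hahnHom k α hsum f).orderTop = v := by
  obtain ⟨R, hR, rfl⟩ := exists_reduced f
  obtain ⟨v, hv0, hv, ho⟩ := hahnEval_orderTop_of_reduced hα hR fun h => hf (by rw [h, map_zero])
  exact ⟨v, hv0, ⟨R, hv, rfl⟩, by rw [hahnHom_qmk, ho]⟩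

theorem hahnHom_injective {α : Fin 4 → ℝ} (hα : ∀ i, α i < 0)
    (hsum : α 0 + α 3 = α 1 + α 2) : Function.Injective (hahnHom k α hsum) := by
  rw [injective_iff_map_eq_zero]
  intro f h
  by_contra hf
  obtain ⟨v, -, -, hv⟩ := exists_rep hα hsum hf
  rw [h, HahnSeries.orderTop_zero] at hv
  exact WithTop.top_ne_coe hv

theorem isDomain_quadRing (k : Type) [Field k] : IsDomain (QuadRing k) :=
  (hahnHom_injective (k := k) (α := fun _ => -1) (by simp) rfl).isDomain

theorem le_mvalP_iff {α : Fin 4 → ℝ} (hα : ∀ i, α i < 0) (p : Fin 4 → k) {v : ℝ}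
    {R : MvPolynomial (Fin 4) k} : (v : WithTop ℝ) ≤ mvalP k p α R ↔ R ∈ weightGE k α v := by
  refine le_mvalO_iff.trans ⟨fun h => ?_, translate_mem_weightGE hα p⟩
  have := translate_mem_weightGE hα (fun i => -p i) h
  have e : (aeval fun i => X i + C (-p i)).comp
      (aeval (fun i => X i + C (p i)) : MvPolynomial (Fin 4) k →ₐ[k] _) = AlgHom.id k _ := by
    ext i; simp
  have e' := DFunLike.congr_fun e R
  rw [AlgHom.comp_apply] at e'
  rwa [e'] at this

theorem nuSup_eq_orderTop {α : Fin 4 → ℝ} (hα : ∀ i, α i < 0)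
    (hsum : α 0 + α 3 = α 1 + α 2) (p : Fin 4 → k) (f : QuadRing k) :
    nuSup k p α f = (hahnHom k α hsum f).orderTop := by
  by_cases hf : f = 0
  · rw [hf, map_zero, HahnSeries.orderTop_zero, nuSup]
    exact WithTop.sSup_of_top_mem ⟨0, map_zero _, by simp [mvalP]⟩
  · obtain ⟨v, hv0, ⟨R, hR, hRf⟩, hv⟩ := exists_rep hα hsum hf
    rw [hv, nuSup]
    have hle : ∀ w ∈ {v : WithTop ℝ | ∃ R, qmk k R = f ∧ mvalP k p α R = v},
        w ≤ (v : WithTop ℝ) := by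
      rintro w ⟨S, hS, rfl⟩
      induction h : mvalP k p α S using WithTop.recTopCoe with
      | top =>
        exfalso
        have h1 : ((v + 1 : ℝ) : WithTop ℝ) ≤ (hahnEval k α S).orderTop :=
          hahnEval_le_orderTop hα ((le_mvalP_iff hα p).1 (h.symm ▸ le_top))
        rw [← hahnHom_qmk hsum, hS, hv, WithTop.coe_le_coe] at h1
        linarith
      | coe w =>
        rw [← hv, ← hS, hahnHom_qmk]
        exact hahnEval_le_orderTop hα ((le_mvalP_iff hα p).1 h.ge)
    have hmem : (v : WithTop ℝ) ∈ {v : WithTop ℝ | ∃ R, qmk k R = f ∧ mvalP k p α R = v} :=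
      ⟨R, hRf, le_antisymm (hle _ ⟨R, hRf, rfl⟩) ((le_mvalP_iff hα p).2 hR)⟩
    exact (WithTop.isLUB_sSup' ⟨_, hmem⟩).unique ⟨hle, fun _ hb => hb hmem⟩

end ValuationAsOrder

section Jacobian

variable {k : Type} [Field k]

/-- The gradient of a polynomial. -/
def polyGrad (k : Type) [Field k] (R : MvPolynomial (Fin 4) k) : Fin 4 → MvPolynomial (Fin 4) k :=
  fun j => pderiv j R

theorem polyGrad_mul (R S : MvPolynomial (Fin 4) k) :
    polyGrad k (R * S) = R • polyGrad k S + S • polyGrad k R := by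
  ext1 j
  simp [polyGrad, Derivation.leibniz]

theorem polyGrad_add (R S : MvPolynomial (Fin 4) k) :
    polyGrad k (R + S) = polyGrad k R + polyGrad k S := by
  ext1 j
  simp [polyGrad]

theorem polyGrad_smul (c : k) (R : MvPolynomial (Fin 4) k) :
    polyGrad k (c • R) = (C c : MvPolynomial (Fin 4) k) • polyGrad k R := by
  ext1 j
  simp [polyGrad, MvPolynomial.smul_eq_C_mul]

theorem polyGrad_X (i : Fin 4) : polyGrad k (X i) = Pi.single i 1 := by
  ext1 j
  simp [polyGrad, pderiv_X, Pi.single_apply, eq_comm]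

theorem jac_eq_det_updateRow (q F G S : MvPolynomial (Fin 4) k) :
    jac k ![q, F, G, S] =
      ((Matrix.of ![polyGrad k q, polyGrad k F, 0, polyGrad k S]).updateRow 2
        (polyGrad k G)).det := by
  rw [jac]
  congr 1
  ext i j
  fin_cases i <;> rfl

/-- The Jacobian `Jac(q, F, -, S)` as a derivation. -/
def jacDer (k : Type) [Field k] (F S : MvPolynomial (Fin 4) k) :
    Derivation k (MvPolynomial (Fin 4) k) (MvPolynomial (Fin 4) k) :=
  Derivation.mk'
    { toFun := fun G => jac k ![qpoly k, F, G, S]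
      map_add' := fun G H => by
        simp only [jac_eq_det_updateRow, polyGrad_add, Matrix.det_updateRow_add]
      map_smul' := fun c G => by
        rw [jac_eq_det_updateRow, polyGrad_smul, Matrix.det_updateRow_smul,
          RingHom.id_apply, MvPolynomial.smul_eq_C_mul, jac_eq_det_updateRow] }
    fun G H => by
      simp only [LinearMap.coe_mk, AddHom.coe_mk, jac_eq_det_updateRow, polyGrad_mul,
        Matrix.det_updateRow_add, Matrix.det_updateRow_smul, smul_eq_mul]

theorem jacDer_apply (F S G : MvPolynomial (Fin 4) k) :
    jacDer k F S G = jac k ![qpoly k, F, G, S] := rfl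

theorem jacDer_qpoly (F S : MvPolynomial (Fin 4) k) : jacDer k F S (qpoly k) = 0 := by
  rw [jacDer_apply, jac]
  exact Matrix.det_zero_of_row_eq (show (0 : Fin 4) ≠ 2 by decide) rfl

theorem jacDer_self (F S : MvPolynomial (Fin 4) k) : jacDer k F S F = 0 := by
  rw [jacDer_apply, jac]
  exact Matrix.det_zero_of_row_eq (show (1 : Fin 4) ≠ 2 by decide) rfl

theorem exists_eq_add_of_qmk_eq {R S : MvPolynomial (Fin 4) k} (h : qmk k R = qmk k S) :
    ∃ T, R = S + (qpoly k - 1) * T := by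
  obtain ⟨T, hT⟩ := Ideal.mem_span_singleton.1 (Ideal.Quotient.eq.1 h)
  exact ⟨T, by rw [← hT]; ring⟩

theorem qmk_qpoly_sub_one : qmk k (qpoly k - 1) = 0 :=
  Ideal.Quotient.eq_zero_iff_mem.2 (Ideal.mem_span_singleton_self _)

theorem qmk_jacDer_congr (F S : MvPolynomial (Fin 4) k) {G H : MvPolynomial (Fin 4) k}
    (h : qmk k G = qmk k H) : qmk k (jacDer k F S G) = qmk k (jacDer k F S H) := by
  obtain ⟨T, rfl⟩ := exists_eq_add_of_qmk_eq h
  rw [map_add, Derivation.leibniz, map_sub, jacDer_qpoly, Derivation.map_one_eq_zero,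
    sub_zero, smul_zero, add_zero, smul_eq_mul, map_add, map_mul, qmk_qpoly_sub_one, zero_mul,
    add_zero]

/-- Bound on `ν(Jac(q, F, G, X i))` in terms of `ν(F)` and `ν(G)`. -/
theorem jacDer_X_mem_weightGE {α : Fin 4 → ℝ} (hsum : α 0 + α 3 = α 1 + α 2)
    {F G : MvPolynomial (Fin 4) k} {b v : ℝ} (hF : F ∈ weightGE k α b)
    (hG : G ∈ weightGE k α v) (i : Fin 4) :
    jacDer k F (X i) G ∈ weightGE k α (v + b + (α i - (α 0 + α 3))) := by
  have h := jac_mem_weightGE (α := α) (v := ![α 0 + α 3, b, v, α i])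
    (R := ![qpoly k, F, G, X i]) (by
      intro j
      fin_cases j
      · exact qpoly_mem_weightGE hsum
      · exact hF
      · exact hG
      · exact X_mem_weightGE α i)
  refine weightGE_mono (le_of_eq ?_) h
  simp only [Fin.sum_univ_four, Matrix.cons_val]
  linarith

theorem weight_gap_pos {α : Fin 4 → ℝ} (hα : ∀ i, α i < 0) (hsum : α 0 + α 3 = α 1 + α 2)
    (i : Fin 4) : 0 < α i - (α 0 + α 3) := by
  have h0 := hα 0
  have h1 := hα 1
  have h2 := hα 2
  have h3 := hα 3
  fin_cases i <;> simp <;> linarith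

/-- The Jacobian of a component of an automorphism with some coordinate does not vanish. -/
theorem exists_jacDer_X_ne_zero {F1 F2 : MvPolynomial (Fin 4) k}
    (h : IsComponent k (qmk k F1) (qmk k F2)) :
    ∃ i, qmk k (jacDer k F2 (X i) F1) ≠ 0 := by
  classical
  have := isDomain_quadRing k
  obtain ⟨σ, h1, h2⟩ := h
  obtain ⟨F3, h3⟩ := Ideal.Quotient.mk_surjective (σ (qmk k (X 2)))
  obtain ⟨F4, h4⟩ := Ideal.Quotient.mk_surjective (σ (qmk k (X 3)))
  replace h3 : qmk k F3 = σ (qmk k (X 2)) := h3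
  replace h4 : qmk k F4 = σ (qmk k (X 3)) := h4
  let ι : MvPolynomial (Fin 4) k →+* FractionRing (QuadRing k) :=
    (algebraMap (QuadRing k) _).comp (qmk k)
  have hι : ∀ R, ι R = 0 ↔ qmk k R = 0 := fun R => by
    change algebraMap (QuadRing k) (FractionRing (QuadRing k)) (qmk k R) = 0 ↔ _
    exact IsFractionRing.to_map_eq_zero_iff
  let w : MvPolynomial (Fin 4) k → Fin 4 → FractionRing (QuadRing k) :=
    fun R j => ι (polyGrad k R j)
  have w_add : ∀ R S, w (R + S) = w R + w S := fun R S => by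
    ext j; simp [w, polyGrad_add]
  have w_mul : ∀ R S, w (R * S) = ι R • w S + ι S • w R := fun R S => by
    ext j; simp [w, polyGrad_mul]
  have w_C : ∀ c, w (C c) = 0 := fun c => by
    ext j; simp [w, polyGrad]
  let b : Fin 4 → Fin 4 → FractionRing (QuadRing k) := ![w (qpoly k), w F2, w F1, w F3]
  set V := Submodule.span (FractionRing (QuadRing k)) (Set.range b) with hV
  have hq : w (qpoly k) ∈ V := Submodule.subset_span ⟨0, rfl⟩
  have hF2 : w F2 ∈ V := Submodule.subset_span ⟨1, rfl⟩
  have hF1 : w F1 ∈ V := Submodule.subset_span ⟨2, rfl⟩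
  have hF3 : w F3 ∈ V := Submodule.subset_span ⟨3, rfl⟩
  have hideal : ∀ T, w ((qpoly k - 1) * T) ∈ V := by
    intro T
    have e1 : ι (qpoly k - 1) = 0 := (hι _).2 qmk_qpoly_sub_one
    have e2 : w (qpoly k - 1) = w (qpoly k) := by
      have := w_add (qpoly k) (C (-1))
      rw [w_C, add_zero] at this
      rwa [map_neg, C_1, ← sub_eq_add_neg] at this
    rw [w_mul, e1, zero_smul, zero_add, e2]
    exact V.smul_mem _ hq
  have hF4 : w F4 ∈ V := by
    have hrel : qmk k (F1 * F4) = qmk k (F2 * F3 + C 1) := by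
      rw [map_mul, h4, ← h1, ← map_mul, ← map_mul, qmk_X_zero_mul_X_three, map_add, map_add,
        map_add, map_mul, map_mul, map_mul, ← h3, C_1, map_one, map_one, h2, add_comm]
    obtain ⟨T, hT⟩ := exists_eq_add_of_qmk_eq hrel
    have e := congrArg w hT
    rw [w_mul, w_add, w_add, w_mul, w_C] at e
    have hne : ι F1 ≠ 0 := by
      rw [Ne, hι, ← h1, map_eq_zero_iff σ σ.injective]
      intro h0
      have h0' := congrArg (hahnHom k (fun _ => -1) (by norm_num)) h0
      rw [hahnHom_qmk, map_zero, hahnEval, eval₂Hom_X'] at h0'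
      have h1' : (AddMonoidAlgebra.single ((1, 0, 0) : ℤ × ℤ × ℤ) (1 : k)) = 0 :=
        HahnSeries.single_eq_zero_iff.1 h0'
      exact one_ne_zero (AddMonoidAlgebra.single_eq_zero.1 h1')
    have hmem : ι F1 • w F4 ∈ V := by
      rw [eq_sub_of_add_eq e]
      exact V.sub_mem (V.add_mem (V.add_mem (V.add_mem (V.smul_mem _ hF3) (V.smul_mem _ hF2))
        V.zero_mem) (hideal T)) (V.smul_mem _ hF1)
    exact (V.smul_mem_iff hne).1 hmem
  have hF : ∀ i, w (![F1, F2, F3, F4] i) ∈ V := by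
    intro i
    fin_cases i
    · exact hF1
    · exact hF2
    · exact hF3
    · exact hF4
  have haev : ∀ G : MvPolynomial (Fin 4) k, w (aeval ![F1, F2, F3, F4] G) ∈ V := by
    intro G
    induction G using MvPolynomial.induction_on with
    | C c => 
      rw [aeval_C, algebraMap_eq, w_C]
      exact V.zero_mem
    | add P P' h h' => rw [map_add, w_add]; exact V.add_mem h h'
    | mul_X P i h =>
      rw [map_mul, aeval_X, w_mul]
      exact V.add_mem (V.smul_mem _ (hF i)) (V.smul_mem _ h)
  have hσ : ∀ G, σ (qmk k G) = qmk k (aeval ![F1, F2, F3, F4] G) := by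
    intro G
    induction G using MvPolynomial.induction_on with
    | C c =>
      rw [aeval_C, algebraMap_eq]
      exact σ.commutes c
    | add P P' h h' => rw [map_add, map_add, map_add, map_add, h, h']
    | mul_X P i h =>
      rw [map_mul, map_mul, map_mul, map_mul, h, aeval_X]
      congr 1
      fin_cases i
      · exact h1
      · exact h2
      · exact h3.symm
      · exact h4.symm
  have hall : ∀ G, w G ∈ V := by
    intro G
    obtain ⟨G', hG'⟩ := Ideal.Quotient.mk_surjective (σ.symm (qmk k G))
    have e : qmk k G = qmk k (aeval ![F1, F2, F3, F4] G') := by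
      rw [← hσ, show qmk k G' = _ from hG', σ.apply_symm_apply]
    obtain ⟨T, hT⟩ := exists_eq_add_of_qmk_eq e
    rw [hT, w_add]
    exact V.add_mem (haev _) (hideal T)
  have htop : ⊤ ≤ V := by
    rw [← (Pi.basisFun (FractionRing (QuadRing k)) (Fin 4)).span_eq, Submodule.span_le]
    rintro _ ⟨i, rfl⟩
    have e : w (X i) = Pi.basisFun (FractionRing (QuadRing k)) (Fin 4) i := by
      ext j
      simp only [w, polyGrad_X, Pi.basisFun_apply, Pi.single_apply]
      split_ifs <;> simp
    rw [← e]
    exact hall _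
  have hli := linearIndependent_of_top_le_span_of_card_eq_finrank htop (by simp)
  have hdet : (Matrix.of b).det ≠ 0 := by
    have := (Matrix.linearIndependent_rows_iff_isUnit (A := Matrix.of b)).1 hli
    exact ((Matrix.isUnit_iff_isUnit_det _).1 this).ne_zero
  by_contra! hzero
  refine hdet ?_
  have hadj : ∀ j, (Matrix.of b).adjugate j 3 = 0 := by
    intro j
    have hj := hzero j
    rw [← hι, jacDer_apply, jac, RingHom.map_det] at hj
    rw [Matrix.adjugate_apply, ← hj]
    congr 1
    ext i l
    fin_cases i
    · rfl
    · rfl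
    · rfl
    · simp [pderiv_X, Pi.single_apply, apply_ite ι, eq_comm]
  have h33 := congrFun (congrFun (Matrix.of b).mul_adjugate 3) 3
  rw [Matrix.mul_apply] at h33
  simpa [hadj] using h33.symm

end Jacobian

section BivariateEvaluation

variable {k : Type} [Field k]

/-- Evaluation of `T ∈ k[Y][X]` at `X = f₁`, `Y = f₂`. -/
def biEval {B : Type} [CommRing B] [Algebra k B] (f1 f2 : B) :
    Polynomial (Polynomial k) →+* B :=
  Polynomial.eval₂RingHom (Polynomial.aeval f2 : Polynomial k →ₐ[k] B).toRingHom f1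

theorem biEval_apply {B : Type} [CommRing B] [Algebra k B] (f1 f2 : B)
    (T : Polynomial (Polynomial k)) :
    biEval f1 f2 T = T.eval₂ (Polynomial.aeval f2 : Polynomial k →ₐ[k] B).toRingHom f1 := rfl

theorem Derivation.map_biEval {B : Type} [CommRing B] [Algebra k B] (D : Derivation k B B)
    {f1 f2 : B} (h : D f2 = 0) (T : Polynomial (Polynomial k)) :
    D (biEval f1 f2 T) = biEval f1 f2 (Polynomial.derivative T) * D f1 := by
  induction T using Polynomial.induction_on' with
  | add p q hp hq => rw [map_add, map_add, hp, hq, map_add, map_add, add_mul]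
  | monomial n c =>
    rw [biEval_apply, biEval_apply, Polynomial.derivative_monomial, Polynomial.eval₂_monomial,
      Polynomial.eval₂_monomial, Derivation.leibniz, Derivation.leibniz_pow]
    have hc : D ((Polynomial.aeval f2 : Polynomial k →ₐ[k] B).toRingHom c) = 0 := by
      change D (Polynomial.aeval f2 c) = 0
      rw [Derivation.map_aeval, h, smul_zero]
    rw [hc, smul_zero, add_zero, map_mul, _root_.map_natCast]
    simp only [smul_eq_mul, nsmul_eq_mul]
    ring

theorem qmk_biEval (F1 F2 : MvPolynomial (Fin 4) k) (T : Polynomial (Polynomial k)) :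
    qmk k (biEval F1 F2 T) = biEval (qmk k F1) (qmk k F2) T := by
  rw [biEval_apply, biEval_apply, Polynomial.hom_eval₂]
  congr 1
  refine Polynomial.ringHom_ext (fun c => ?_) ?_
  · change qmk k (Polynomial.aeval F2 (Polynomial.C c)) =
      Polynomial.aeval (qmk k F2) (Polynomial.C c)
    rw [Polynomial.aeval_C, Polynomial.aeval_C]
    rfl
  · simp

theorem hom_biEval {B H : Type} [CommRing B] [Algebra k B] [CommRing H] (Φ : B →+* H)
    (f1 f2 : B) (T : Polynomial (Polynomial k)) :
    Φ (biEval f1 f2 T) =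
      (T.map (Φ.comp (Polynomial.aeval f2 : Polynomial k →ₐ[k] B).toRingHom)).eval (Φ f1) := by
  rw [biEval_apply, Polynomial.hom_eval₂, Polynomial.eval_map]

/-- A bivariate polynomial, seen in `k[Y][X]`. -/
def toBivariate (k : Type) [Field k] :
    MvPolynomial (Fin 2) k →+* Polynomial (Polynomial k) :=
  (Polynomial.mapRingHom (uniqueAlgEquiv k (Fin 1) : _ →+* Polynomial k)).comp
    (finSuccEquiv k 1 : _ →+* Polynomial (MvPolynomial (Fin 1) k))

theorem natDegree_toBivariate (R : MvPolynomial (Fin 2) k) :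
    (toBivariate k R).natDegree = R.degreeOf 0 := by
  rw [← natDegree_finSuccEquiv]
  exact Polynomial.natDegree_map_eq_of_injective (uniqueAlgEquiv k (Fin 1)).injective _

theorem biEval_toBivariate {B : Type} [CommRing B] [Algebra k B] (f1 f2 : B)
    (R : MvPolynomial (Fin 2) k) :
    biEval f1 f2 (toBivariate k R) = MvPolynomial.aeval ![f1, f2] R := by
  induction R using MvPolynomial.induction_on with
  | C c =>
    rw [aeval_C]
    simp [toBivariate, biEval_apply, finSuccEquiv_apply]
  | add p q hp hq => rw [map_add, map_add, map_add, hp, hq]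
  | mul_X p i h =>
    rw [map_mul, map_mul, map_mul, h, aeval_X]
    congr 1
    fin_cases i
    · simp [toBivariate, biEval_apply, finSuccEquiv_apply]
    · have e : finSuccEquiv k 1 (X 1) = Polynomial.C (X 0) := finSuccEquiv_X_succ (j := 0)
      simp [toBivariate, biEval_apply, e]

end BivariateEvaluation

section DerivativeBounds

variable {k : Type} [Field k] {α : Fin 4 → ℝ}

theorem exists_mem_weightGE_of_le_orderTop (hα : ∀ i, α i < 0) (hsum : α 0 + α 3 = α 1 + α 2)
    {g : QuadRing k} {v : ℝ} (h : (v : WithTop ℝ) ≤ (hahnHom k α hsum g).orderTop) :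
    ∃ G ∈ weightGE k α v, qmk k G = g := by
  by_cases hg : g = 0
  · exact ⟨0, Submodule.zero_mem _, by rw [hg, map_zero]⟩
  · obtain ⟨w, -, ⟨R, hR, e⟩, hw⟩ := exists_rep hα hsum hg
    rw [hw, WithTop.coe_le_coe] at h
    exact ⟨R, weightGE_mono h hR, e⟩

/-- Differentiation with respect to the first variable does not decrease the valuation by more
than `-(ν f₂ + ε)`. -/
theorem exists_le_orderTop_biEval_derivative (hα : ∀ i, α i < 0)
    (hsum : α 0 + α 3 = α 1 + α 2) {f1 f2 : QuadRing k} (h : IsComponent k f1 f2) {b : ℝ}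
    (hb : (hahnHom k α hsum f2).orderTop = b) :
    ∃ ε : ℝ, 0 < ε ∧ ∀ (T : Polynomial (Polynomial k)) (v : ℝ),
      (v : WithTop ℝ) ≤ (hahnHom k α hsum (biEval f1 f2 T)).orderTop →
      ((v + (b + ε) : ℝ) : WithTop ℝ) ≤
        (hahnHom k α hsum (biEval f1 f2 (Polynomial.derivative T))).orderTop := by
  obtain ⟨F2, hF2, rfl⟩ := exists_mem_weightGE_of_le_orderTop hα hsum hb.ge
  obtain ⟨F1, rfl⟩ : ∃ F1, qmk k F1 = f1 := Ideal.Quotient.mk_surjective f1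
  obtain ⟨i, hi⟩ := exists_jacDer_X_ne_zero h
  refine ⟨_, weight_gap_pos hα hsum i, fun T v hv => ?_⟩
  obtain ⟨G, hG, hGT⟩ := exists_mem_weightGE_of_le_orderTop hα hsum hv
  have h1 := hahnEval_le_orderTop hα (jacDer_X_mem_weightGE hsum hF2 hG i)
  rw [← hahnHom_qmk hsum, qmk_jacDer_congr F2 (X i) (hGT.trans (qmk_biEval F1 F2 T).symm),
    Derivation.map_biEval _ (jacDer_self F2 (X i)), map_mul, map_mul, qmk_biEval,
    HahnSeries.orderTop_mul] at h1
  obtain ⟨w, hw0, -, hw⟩ := exists_rep hα hsum hi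
  rw [hw, add_assoc] at h1
  refine h1.trans ?_
  conv_rhs => rw [← add_zero (HahnSeries.orderTop _)]
  gcongr
  exact WithTop.coe_le_coe.2 hw0

theorem exists_le_orderTop_biEval_iterate_derivative (hα : ∀ i, α i < 0)
    (hsum : α 0 + α 3 = α 1 + α 2) {f1 f2 : QuadRing k} (h : IsComponent k f1 f2) {b : ℝ}
    (hb : (hahnHom k α hsum f2).orderTop = b) :
    ∃ ε : ℝ, 0 < ε ∧ ∀ (T : Polynomial (Polynomial k)) (v : ℝ) (n : ℕ),
      (v : WithTop ℝ) ≤ (hahnHom k α hsum (biEval f1 f2 T)).orderTop →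
      ((v + n * (b + ε) : ℝ) : WithTop ℝ) ≤
        (hahnHom k α hsum (biEval f1 f2 (Polynomial.derivative^[n] T))).orderTop := by
  obtain ⟨ε, hε, H⟩ := exists_le_orderTop_biEval_derivative hα hsum h hb
  refine ⟨ε, hε, fun T v n hv => ?_⟩
  induction n with
  | zero => simpa using hv
  | succ n ih =>
    have := H _ _ ih
    rw [← Function.iterate_succ_apply' Polynomial.derivative] at this
    convert this using 2
    push_cast
    ring

theorem orderTop_algebraMap (hα : ∀ i, α i < 0) (hsum : α 0 + α 3 = α 1 + α 2) {c : k} :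
    ((0 : ℝ) : WithTop ℝ) ≤ (hahnHom k α hsum (algebraMap k _ c)).orderTop := by
  have h := hahnEval_le_orderTop hα (C_mem_weightGE α c)
  rwa [← hahnHom_qmk hsum] at h

theorem orderTop_aeval (hα : ∀ i, α i < 0) (hsum : α 0 + α 3 = α 1 + α 2) {f : QuadRing k}
    {b : ℝ} (hb : (hahnHom k α hsum f).orderTop = b) (hb0 : b < 0) {ρ : Polynomial k}
    (hρ : ρ ≠ 0) :
    (hahnHom k α hsum (Polynomial.aeval f ρ)).orderTop = ((b * ρ.natDegree : ℝ) : WithTop ℝ) := by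
  have := isDomain_quadRing k
  obtain ⟨n, hn⟩ : ∃ n, ρ.natDegree = n := ⟨_, rfl⟩
  rw [hn]
  induction n generalizing ρ with
  | zero =>
    rw [Polynomial.eq_C_of_natDegree_eq_zero hn, Polynomial.aeval_C]
    have hc : ρ.coeff 0 ≠ 0 := fun h0 => hρ (by
      rw [Polynomial.eq_C_of_natDegree_eq_zero hn, h0, map_zero])
    obtain ⟨w, hw0, -, hw⟩ := exists_rep (k := k) hα hsum
      ((map_ne_zero_iff _ (algebraMap k (QuadRing k)).injective).2 hc)
    refine le_antisymm ?_ ?_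
    · rw [hw]; simpa using hw0
    · simpa using orderTop_algebraMap (k := k) hα hsum (c := ρ.coeff 0)
  | succ n ih =>
    have hd : ρ.divX.natDegree = n := by
      rw [Polynomial.natDegree_divX_eq_natDegree_tsub_one, hn]; rfl
    have hd0 : ρ.divX ≠ 0 := by
      intro h0
      have := ρ.divX_mul_X_add
      rw [h0, zero_mul, zero_add] at this
      rw [← this, Polynomial.natDegree_C] at hn
      omega
    have h1 : (hahnHom k α hsum (Polynomial.aeval f ρ.divX * f)).orderTop =
        ((b * (n + 1 : ℕ) : ℝ) : WithTop ℝ) := by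
      rw [map_mul, HahnSeries.orderTop_mul, ih hd0 hd, hb, ← WithTop.coe_add]
      congr 1
      push_cast
      ring
    have h2 : ((b * (n + 1 : ℕ) : ℝ) : WithTop ℝ) < ((0 : ℝ) : WithTop ℝ) :=
      WithTop.coe_lt_coe.2 (mul_neg_of_neg_of_pos hb0 (by positivity))
    rw [← ρ.divX_mul_X_add, map_add, map_mul, Polynomial.aeval_X, Polynomial.aeval_C, map_add,
      HahnSeries.orderTop_add_eq_left, h1]
    rw [h1]
    exact h2.trans_le (orderTop_algebraMap hα hsum)

/-- If `s₁ ν(f₁) = s₂ ν(f₂)` with `s₁`, `s₂` coprime, then some iterated derivative of `S` with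
respect to the first variable has no cancellation of leading terms at `(f₁, f₂)`. -/
theorem exists_orderTop_biEval_iterate_derivative_le [IsAlgClosed k] [CharZero k]
    (hα : ∀ i, α i < 0) (hsum : α 0 + α 3 = α 1 + α 2) {f1 f2 : QuadRing k} {a b : ℝ}
    (ha : (hahnHom k α hsum f1).orderTop = a) (hb : (hahnHom k α hsum f2).orderTop = b)
    (ha0 : a < 0) (hb0 : b < 0) {s1 s2 : ℕ} (hs1 : 0 < s1) (hs2 : 0 < s2)
    (hcop : Nat.Coprime s1 s2) (hres : (s1 : ℝ) * a = s2 * b)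
    {S : Polynomial (Polynomial k)} (hS : 0 < S.natDegree) :
    ∃ (W : ℝ) (n : ℕ), W ≤ a ∧ W ≤ a * (s1 * n) ∧
      (hahnHom k α hsum (biEval f1 f2 (Polynomial.derivative^[n] S))).orderTop ≤
        ((W - a * n : ℝ) : WithTop ℝ) := by
  have hS0 : S ≠ 0 := by rintro rfl; simp at hS
  set u : ℕ → ℝ := fun i => b * (S.coeff i).natDegree + a * i with hu
  obtain ⟨i₀, hi₀, hmin⟩ := S.support.exists_min_image u (Polynomial.nonempty_support_iff.2 hS0)
  rw [Polynomial.mem_support_iff] at hi₀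
  replace hmin : ∀ i, S.coeff i ≠ 0 → u i₀ ≤ u i := fun i hi =>
    hmin i (Polynomial.mem_support_iff.2 hi)
  set W := u i₀ with hW
  set Φ := hahnHom k α hsum
  set ψ := Φ.comp (Polynomial.aeval f2 : Polynomial k →ₐ[k] QuadRing k).toRingHom
  have hψ : ∀ i, S.coeff i ≠ 0 →
      ((S.map ψ).coeff i).orderTop = ((b * (S.coeff i).natDegree : ℝ) : WithTop ℝ) := by
    intro i hi
    rw [Polynomial.coeff_map]
    exact orderTop_aeval hα hsum hb hb0 hi
  have hP : ∀ i : ℕ, ((W - a * i : ℝ) : WithTop ℝ) ≤ ((S.map ψ).coeff i).orderTop := by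
    intro i
    by_cases hi : S.coeff i = 0
    · rw [Polynomial.coeff_map, hi, map_zero, HahnSeries.orderTop_zero]
      exact le_top
    · rw [hψ i hi, WithTop.coe_le_coe, sub_le_iff_le_add]
      exact hmin i hi
  set p := initialForm a W (S.map ψ) with hp
  have hpc : ∀ i, p.coeff i ≠ 0 → W = u i := by
    intro i hi
    rw [hp, coeff_initialForm] at hi
    have hi' : S.coeff i ≠ 0 := by
      intro h0
      rw [Polynomial.coeff_map, h0, map_zero] at hi
      exact hi HahnSeries.coeff_zero
    have h1 := HahnSeries.orderTop_le_of_coeff_ne_zero hi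
    rw [hψ i hi', WithTop.coe_le_coe] at h1
    refine le_antisymm (hmin i hi') ?_
    rw [hu]
    linarith
  have hp0 : p ≠ 0 := by
    intro h0
    have h1 : p.coeff i₀ = 0 := by rw [h0, Polynomial.coeff_zero]
    rw [hp, coeff_initialForm] at h1
    refine HahnSeries.coeff_orderTop_ne ?_ h1
    rw [hψ i₀ hi₀, hW, hu]
    congr 1
    ring
  have hmod : ∀ i j, p.coeff i ≠ 0 → p.coeff j ≠ 0 → i ≡ j [MOD s1] := by
    intro i j hi hj
    have h1 : u i = u j := (hpc i hi).symm.trans (hpc j hj)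
    have hs2' : (s2 : ℝ) ≠ 0 := by positivity
    have hbe : b = s1 * (a / s2) := by field_simp; linarith
    have hae : a = s2 * (a / s2) := by field_simp
    have h2 : (s1 * (S.coeff i).natDegree + s2 * i : ℝ) =
        s1 * (S.coeff j).natDegree + s2 * j := by
      refine mul_right_cancel₀ (div_ne_zero ha0.ne hs2') ?_
      have e : ∀ l, (s1 * (S.coeff l).natDegree + s2 * l : ℝ) * (a / s2) = u l := by
        intro l
        change _ = b * _ + a * _
        rw [hbe]
        conv_rhs => rw [hae]
        field_simp
      rw [e, e, h1]
    have h3 : s1 * (S.coeff i).natDegree + s2 * i = s1 * (S.coeff j).natDegree + s2 * j := by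
      exact_mod_cast h2
    refine Nat.ModEq.cancel_left_of_coprime hcop ?_
    have h4 := congrArg (· % s1) h3
    simpa [Nat.ModEq] using h4
  have hc0 : (Φ f1).coeff a ≠ 0 := HahnSeries.coeff_orderTop_ne ha
  obtain ⟨ζ, hζ⟩ : ∃ ζ : k, IsPrimitiveRoot ζ s1 := by
    have : NeZero (s1 : k) := ⟨Nat.cast_ne_zero.2 hs1.ne'⟩
    exact HasEnoughRootsOfUnity.exists_primitiveRoot k s1
  have hζ' := hζ.map_of_injective (f := algebraMap k (AddMonoidAlgebra k (ℤ × ℤ × ℤ)))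
    (algebraMap k (AddMonoidAlgebra k (ℤ × ℤ × ℤ))).injective
  have hroot := mul_rootMultiplicity_le_natDegree hp0 hs1 hζ' hmod hc0
  set n := p.rootMultiplicity ((Φ f1).coeff a)
  refine ⟨W, n, ?_, ?_, ?_⟩
  · refine (hmin _ (Polynomial.leadingCoeff_ne_zero.2 hS0)).trans ?_
    have h1 : (1 : ℝ) ≤ S.natDegree := by exact_mod_cast hS
    have h2 : b * (S.coeff S.natDegree).natDegree ≤ 0 :=
      mul_nonpos_of_nonpos_of_nonneg hb0.le (Nat.cast_nonneg _)
    change b * _ + a * _ ≤ a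
    nlinarith
  · have h1 := hpc _ (Polynomial.leadingCoeff_ne_zero.2 hp0)
    have h2 : b * (S.coeff p.natDegree).natDegree ≤ 0 :=
      mul_nonpos_of_nonpos_of_nonneg hb0.le (Nat.cast_nonneg _)
    have h3 : (s1 * n : ℝ) ≤ p.natDegree := by exact_mod_cast hroot
    rw [h1]
    change b * _ + a * _ ≤ _
    nlinarith
  · refine HahnSeries.orderTop_le_of_coeff_ne_zero ?_
    rw [hom_biEval, ← Polynomial.iterate_derivative_map,
      (le_orderTop_eval_and_coeff (le_orderTop_coeff_iterate_derivative hP n) ha.ge).2,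
      initialForm_iterate_derivative, Polynomial.eval_iterate_derivative_rootMultiplicity,
      ← Nat.cast_smul_eq_nsmul k]
    exact smul_ne_zero (Nat.cast_ne_zero.2 (Nat.factorial_ne_zero _))
      (Polynomial.eval_divByMonic_pow_rootMultiplicity_ne_zero _ hp0)

end DerivativeBounds

/-- Corollary 4.20: let `ν ∈ 𝒱₀` and let `(f₁, f₂)` be a component of
an automorphism of `Q` which is properly resonant with respect to `ν` (there are coprime
integers `s₁, s₂ ≥ 2` with `s₁·ν(f₁) = s₂·ν(f₂)`) and satisfies `ν(f₁) < ν(f₂)` (with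
`ν(f₁) = a`, `ν(f₂) = b`). Then for every polynomial `R ∈ k[X,Y] ∖ k[Y]` (i.e. of
positive degree in `X`), one has `ν(f₁ · R(f₁,f₂)) < (4/3)·ν(f₁)`. -/
theorem val_mul_lt_of_properly_resonant (k : Type) [Field k] [IsAlgClosed k] [CharZero k]
    (ν : QuadRing k → WithTop ℝ) (hν : ν ∈ V0 k)
    (f1 f2 : QuadRing k) (hcomp : IsComponent k f1 f2)
    (a b : ℝ) (ha : ν f1 = (a : WithTop ℝ)) (hb : ν f2 = (b : WithTop ℝ))
    (hres : ∃ s1 s2 : ℕ, 2 ≤ s1 ∧ 2 ≤ s2 ∧ Nat.Coprime s1 s2 ∧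
      (s1 : ℝ) * a = (s2 : ℝ) * b)
    (hlt : a < b) :
    ∀ R : MvPolynomial (Fin 2) k, 0 < R.degreeOf 0 →
      ν (f1 * MvPolynomial.aeval ![f1, f2] R) < (((4 : ℝ) / 3 * a : ℝ) : WithTop ℝ) := by
  intro R hR
  obtain ⟨p, α, hα, hsum, rfl⟩ := hν
  obtain ⟨s1, s2, hs1, hs2, hcop, hs⟩ := hres
  rw [nuSup_eq_orderTop hα hsum] at ha hb ⊢
  rw [map_mul, HahnSeries.orderTop_mul, ha, ← biEval_toBivariate]
  have hb0 : b < 0 := by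
    obtain ⟨w, hw0, -, hw⟩ := exists_rep hα hsum (f := f2) (by
      rintro rfl
      rw [map_zero, HahnSeries.orderTop_zero] at hb
      exact WithTop.top_ne_coe hb)
    have hbw : b = w := WithTop.coe_injective (hb.symm.trans hw)
    rcases (hbw.trans_le hw0).lt_or_eq with h | h
    · exact h
    · rw [h, mul_zero] at hs
      rw [h] at hlt
      have : (0 : ℝ) < s1 := by positivity
      nlinarith
  have ha0 : a < 0 := hlt.trans hb0
  have hs12 : s1 < s2 := by
    by_contra! h
    have h' : (s2 : ℝ) ≤ s1 := by exact_mod_cast h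
    have : (0 : ℝ) < s2 := by positivity
    nlinarith
  obtain ⟨W, n, hWa, hWn, hW⟩ := exists_orderTop_biEval_iterate_derivative_le hα hsum ha hb ha0 hb0
    (by omega) (by omega) hcop hs (S := toBivariate k R) (by rwa [natDegree_toBivariate])
  obtain ⟨ε, hε, hstep⟩ := exists_le_orderTop_biEval_iterate_derivative hα hsum hcomp hb
  have hbound : ∀ v : ℝ,
      (v : WithTop ℝ) ≤ (hahnHom k α hsum (biEval f1 f2 (toBivariate k R))).orderTop →
      v < a / 3 := by
    intro v hv
    have h1 := WithTop.coe_le_coe.1 ((hstep _ v n hv).trans hW)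
    rcases Nat.eq_zero_or_pos n with rfl | hn
    · simp only [Nat.cast_zero] at h1
      linarith
    · have hn1 : (1 : ℝ) ≤ n := by exact_mod_cast hn
      have h3 : (3 : ℝ) ≤ s2 := by exact_mod_cast (show 3 ≤ s2 by omega)
      have h2 : (2 : ℝ) ≤ s1 := by exact_mod_cast hs1
      have hkey : s1 * a - a - b ≤ a / 3 := by
        have h4 : 3 * b ≥ s1 * a := by nlinarith
        nlinarith
      have hna : (n : ℝ) * (s1 * a - a - b) ≤ n * (a / 3) :=
        mul_le_mul_of_nonneg_left hkey (by positivity)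
      have hne : 0 < n * ε := by positivity
      nlinarith
  have hlt3 : (hahnHom k α hsum (biEval f1 f2 (toBivariate k R))).orderTop <
      ((a / 3 : ℝ) : WithTop ℝ) := by
    by_contra! h
    exact lt_irrefl _ (hbound _ h)
  generalize (hahnHom k α hsum (biEval f1 f2 (toBivariate k R))).orderTop = v at hlt3
  lift v to ℝ using hlt3.ne_top
  rw [← WithTop.coe_add, WithTop.coe_lt_coe]
  rw [WithTop.coe_lt_coe] at hlt3
  linarith
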